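/- arXiv:1810.07575 — 3 statements merged into one kernel-verified Lean document; each statement's English description precedes it below -/
import Mathlib

section
/- Let (P,·) be a partial IP loop and let * be a partial binary operation on the set P with domain T ⊆ Γ(P). Then extending the operation · by setting xy = x*y for all (x,y) ∈ T yields a partial IP loop extending P if and only if the following condition holds: for any x, y, z ∈ P, if (x,y) ∈ T and x*y = z then also all the pairs (z,y⁻¹), (x⁻¹,z), (y,z⁻¹), (z⁻¹,x), (y⁻¹,x⁻¹) belong to T and satisfy z*y⁻¹ = x, x⁻¹*z = y, y*z⁻¹ = x⁻¹, z⁻¹*x = y⁻¹, y⁻¹*x⁻¹ = z⁻¹ (where x⁻¹ denotes the inverse in (P,·)). -/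
/-- A partial IP loop: a set `carrier` with a partial binary operation defined on
a domain `dom ⊆ carrier ×ˢ carrier` (the value of `mul` is only meaningful on `dom`),
with a unit, unique two-sided inverses, and the inverse property. -/
structure PartialIPLoop (α : Type*) where
  carrier : Set α
  one : α
  dom : Set (α × α)
  mul : α → α → α
  inv : α → α
  one_mem : one ∈ carrier
  dom_subset : dom ⊆ carrier ×ˢ carrier
  mul_mem : ∀ x y, (x, y) ∈ dom → mul x y ∈ carrier
  one_mul_dom : ∀ x ∈ carrier, (one, x) ∈ dom
  mul_one_dom : ∀ x ∈ carrier, (x, one) ∈ dom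
  one_mul : ∀ x ∈ carrier, mul one x = x
  mul_one : ∀ x ∈ carrier, mul x one = x
  inv_mem : ∀ x ∈ carrier, inv x ∈ carrier
  mul_inv_dom : ∀ x ∈ carrier, (x, inv x) ∈ dom
  inv_mul_dom : ∀ x ∈ carrier, (inv x, x) ∈ dom
  mul_inv : ∀ x ∈ carrier, mul x (inv x) = one
  inv_mul : ∀ x ∈ carrier, mul (inv x) x = one
  inv_unique : ∀ x ∈ carrier, ∀ y ∈ carrier,
    (x, y) ∈ dom → (y, x) ∈ dom → mul x y = one → mul y x = one → y = inv x
  ip_left_dom : ∀ x y, (x, y) ∈ dom → (inv x, mul x y) ∈ dom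
  ip_right_dom : ∀ x y, (x, y) ∈ dom → (mul x y, inv y) ∈ dom
  ip_left : ∀ x y, (x, y) ∈ dom → mul (inv x) (mul x y) = y
  ip_right : ∀ x y, (x, y) ∈ dom → mul (mul x y) (inv y) = x

namespace PartialIPLoop

variable {α : Type*}

/-- The set of gaps `Γ(P) = (P × P) \ D(P)`. -/
def gaps (P : PartialIPLoop α) : Set (α × α) :=
  (P.carrier ×ˢ P.carrier) \ P.dom

/-- The set `O₂(P)` of elements of order two. -/
def O2 (P : PartialIPLoop α) : Set α :=
  {x ∈ P.carrier | x ≠ P.one ∧ (x, x) ∈ P.dom ∧ P.mul x x = P.one}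

/-- The set `O₃(P)` of elements of order three. -/
def O3 (P : PartialIPLoop α) : Set α :=
  {x ∈ P.carrier | x ≠ P.one ∧ (x, x) ∈ P.dom ∧ (x, P.mul x x) ∈ P.dom ∧
    P.mul x (P.mul x x) = P.one}

/-- `Q` is an extension of `P`: `P ⊆ Q`, `D(P) ⊆ D(Q)`, and the operations
agree on `D(P)`. -/
def Ext (P Q : PartialIPLoop α) : Prop :=
  P.carrier ⊆ Q.carrier ∧ P.dom ⊆ Q.dom ∧
    ∀ x y, (x, y) ∈ P.dom → P.mul x y = Q.mul x y

end PartialIPLoop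

namespace PartialIPLoop

variable {α : Type*}

theorem inv_inv (P : PartialIPLoop α) {x : α} (hx : x ∈ P.carrier) : P.inv (P.inv x) = x :=
  (P.inv_unique _ (P.inv_mem x hx) x hx (P.inv_mul_dom x hx) (P.mul_inv_dom x hx)
    (P.inv_mul x hx) (P.mul_inv x hx)).symm

/-- Two partial IP loops on the same carrier, one extending the other, have the same unit. -/
theorem one_eq_of_ext {P Q : PartialIPLoop α} (hc : Q.carrier = P.carrier)
    (hm : ∀ p ∈ P.dom, Q.mul p.1 p.2 = P.mul p.1 p.2) : Q.one = P.one := by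
  have h1 : Q.one ∈ P.carrier := hc ▸ Q.one_mem
  have h2 : P.one ∈ Q.carrier := hc.symm ▸ P.one_mem
  have h := hm _ (P.mul_one_dom _ h1)
  simp only [P.mul_one _ h1, Q.one_mul _ h2] at h
  exact h.symm

/-- Two partial IP loops on the same carrier, one extending the other, have the same inverses. -/
theorem inv_eq_of_ext {P Q : PartialIPLoop α} (hc : Q.carrier = P.carrier)
    (hd : P.dom ⊆ Q.dom) (hm : ∀ p ∈ P.dom, Q.mul p.1 p.2 = P.mul p.1 p.2)
    {x : α} (hx : x ∈ P.carrier) : Q.inv x = P.inv x := by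
  have hone := one_eq_of_ext hc hm
  refine (Q.inv_unique x (hc ▸ hx) (P.inv x) (hc ▸ P.inv_mem x hx) (hd (P.mul_inv_dom x hx))
    (hd (P.inv_mul_dom x hx)) ?_ ?_).symm
  · rw [hm _ (P.mul_inv_dom x hx), P.mul_inv x hx, hone]
  · rw [hm _ (P.inv_mul_dom x hx), P.inv_mul x hx, hone]

theorem mem_dom_of_mul_inv_mem_dom (P : PartialIPLoop α) {x y z : α} (hy : y ∈ P.carrier)
    (h : (z, P.inv y) ∈ P.dom) (hz : P.mul z (P.inv y) = x) : (x, y) ∈ P.dom := by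
  have := P.ip_right_dom _ _ h
  rwa [hz, P.inv_inv hy] at this

theorem mem_dom_of_inv_mul_mem_dom (P : PartialIPLoop α) {x y z : α} (hx : x ∈ P.carrier)
    (h : (P.inv x, z) ∈ P.dom) (hz : P.mul (P.inv x) z = y) : (x, y) ∈ P.dom := by
  have := P.ip_left_dom _ _ h
  rwa [hz, P.inv_inv hx] at this

open Classical in
/-- The partial IP loop obtained from `P` by filling the gaps in `T` through an operation that
satisfies the two inverse properties. -/
noncomputable def extendThrough (P : PartialIPLoop α) (T : Set (α × α)) (hT : T ⊆ P.gaps)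
    (star : α → α → α) (hstar : ∀ p ∈ T, star p.1 p.2 ∈ P.carrier)
    (hr : ∀ x y, (x, y) ∈ T → (star x y, P.inv y) ∈ T ∧ star (star x y) (P.inv y) = x)
    (hl : ∀ x y, (x, y) ∈ T → (P.inv x, star x y) ∈ T ∧ star (P.inv x) (star x y) = y) :
    PartialIPLoop α :=
  have hdisj : ∀ {p}, p ∈ P.dom → p ∉ T := fun hp h => (hT h).2 hp
  { carrier := P.carrier
    one := P.one
    dom := P.dom ∪ T
    mul := fun x y => if (x, y) ∈ T then star x y else P.mul x y
    inv := P.inv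
    one_mem := P.one_mem
    dom_subset := Set.union_subset P.dom_subset fun _ h => (hT h).1
    mul_mem := by
      rintro x y (h | h)
      · simpa [hdisj h] using P.mul_mem x y h
      · simpa [h] using hstar _ h
    one_mul_dom := fun x hx => Or.inl (P.one_mul_dom x hx)
    mul_one_dom := fun x hx => Or.inl (P.mul_one_dom x hx)
    one_mul := fun x hx => by simpa [hdisj (P.one_mul_dom x hx)] using P.one_mul x hx
    mul_one := fun x hx => by simpa [hdisj (P.mul_one_dom x hx)] using P.mul_one x hx
    inv_mem := P.inv_mem
    mul_inv_dom := fun x hx => Or.inl (P.mul_inv_dom x hx)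
    inv_mul_dom := fun x hx => Or.inl (P.inv_mul_dom x hx)
    mul_inv := fun x hx => by simpa [hdisj (P.mul_inv_dom x hx)] using P.mul_inv x hx
    inv_mul := fun x hx => by simpa [hdisj (P.inv_mul_dom x hx)] using P.inv_mul x hx
    inv_unique := by
      have key : ∀ x ∈ P.carrier, ∀ y ∈ P.carrier, (x, y) ∈ P.dom ∪ T →
          (if (x, y) ∈ T then star x y else P.mul x y) = P.one →
          (x, y) ∈ P.dom ∧ P.mul x y = P.one := by
        rintro x - y hy (h | h) h1
        · exact ⟨h, by simpa [hdisj h] using h1⟩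
        · have h2 := (hr x y h).1
          rw [if_pos h] at h1
          rw [h1] at h2
          exact absurd h2 (hdisj (P.one_mul_dom _ (P.inv_mem y hy)))
      intro x hx y hy h h' h1 h1'
      obtain ⟨h, h1⟩ := key x hx y hy h h1
      obtain ⟨h', h1'⟩ := key y hy x hx h' h1'
      exact P.inv_unique x hx y hy h h' h1 h1'
    ip_left_dom := by
      rintro x y (h | h)
      · simpa [hdisj h] using Or.inl (P.ip_left_dom x y h)
      · simpa [h] using Or.inr (hl x y h).1
    ip_right_dom := by
      rintro x y (h | h)
      · simpa [hdisj h] using Or.inl (P.ip_right_dom x y h)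
      · simpa [h] using Or.inr (hr x y h).1
    ip_left := by
      rintro x y (h | h)
      · simpa [hdisj h, hdisj (P.ip_left_dom x y h)] using P.ip_left x y h
      · simpa [h, (hl x y h).1] using (hl x y h).2
    ip_right := by
      rintro x y (h | h)
      · simpa [hdisj h, hdisj (P.ip_right_dom x y h)] using P.ip_right x y h
      · simpa [h, (hr x y h).1] using (hr x y h).2 }

end PartialIPLoop

/-- Lemma 3 (itersimple): extending the partial operation of a partial IP loop `P`
through a partial operation `*` with domain `T ⊆ Γ(P)` yields a partial IP loop
extending `P` if and only if condition (5) holds. -/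
theorem extension_through_operation_iff {α : Type*} (P : PartialIPLoop α)
    (T : Set (α × α)) (hT : T ⊆ P.gaps)
    (star : α → α → α) (hstar : ∀ p ∈ T, star p.1 p.2 ∈ P.carrier) :
    (∃ Q : PartialIPLoop α, Q.carrier = P.carrier ∧ Q.dom = P.dom ∪ T ∧
        (∀ p ∈ P.dom, Q.mul p.1 p.2 = P.mul p.1 p.2) ∧
        (∀ p ∈ T, Q.mul p.1 p.2 = star p.1 p.2)) ↔
    (∀ x y z : α, (x, y) ∈ T → star x y = z →
        ((z, P.inv y) ∈ T ∧ star z (P.inv y) = x) ∧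
        ((P.inv x, z) ∈ T ∧ star (P.inv x) z = y) ∧
        ((y, P.inv z) ∈ T ∧ star y (P.inv z) = P.inv x) ∧
        ((P.inv z, x) ∈ T ∧ star (P.inv z) x = P.inv y) ∧
        ((P.inv y, P.inv x) ∈ T ∧ star (P.inv y) (P.inv x) = P.inv z)) := by
  constructor
  · rintro ⟨Q, hc, hd, hmP, hmT⟩
    have hdP : P.dom ⊆ Q.dom := hd ▸ Set.subset_union_left
    have hinv : ∀ {x}, x ∈ P.carrier → Q.inv x = P.inv x :=
      PartialIPLoop.inv_eq_of_ext hc hdP hmP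
    have hr : ∀ x y z, (x, y) ∈ T ∧ star x y = z →
        (z, P.inv y) ∈ T ∧ star z (P.inv y) = x := by
      rintro x y _ ⟨h, rfl⟩
      have hQ : (x, y) ∈ Q.dom := hd ▸ Or.inr h
      have hy : y ∈ P.carrier := (hT h).1.2
      have h1 := Q.ip_right_dom x y hQ
      have h2 := Q.ip_right x y hQ
      rw [hinv hy, hmT _ h] at h1 h2
      rcases hd ▸ h1 with h3 | h3
      · exact absurd (P.mem_dom_of_mul_inv_mem_dom hy h3 ((hmP _ h3).symm.trans h2)) (hT h).2
      · exact ⟨h3, (hmT _ h3).symm.trans h2⟩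
    have hl : ∀ x y z, (x, y) ∈ T ∧ star x y = z →
        (P.inv x, z) ∈ T ∧ star (P.inv x) z = y := by
      rintro x y _ ⟨h, rfl⟩
      have hQ : (x, y) ∈ Q.dom := hd ▸ Or.inr h
      have hx : x ∈ P.carrier := (hT h).1.1
      have h1 := Q.ip_left_dom x y hQ
      have h2 := Q.ip_left x y hQ
      rw [hinv hx, hmT _ h] at h1 h2
      rcases hd ▸ h1 with h3 | h3
      · exact absurd (P.mem_dom_of_inv_mul_mem_dom hx h3 ((hmP _ h3).symm.trans h2)) (hT h).2
      · exact ⟨h3, (hmT _ h3).symm.trans h2⟩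
    intro x y z h hz
    have hR := hr x y z ⟨h, hz⟩
    have hL := hl x y z ⟨h, hz⟩
    have hRL := hl _ _ _ hR
    exact ⟨hR, hL, hr _ _ _ hL, hRL, hr _ _ _ hRL⟩
  · intro H
    refine ⟨P.extendThrough T hT star hstar (fun x y h => (H x y _ h rfl).1)
      (fun x y h => (H x y _ h rfl).2.1), rfl, rfl, fun p hp => ?_, fun p hp => ?_⟩
    · exact if_neg fun h => (hT h).2 hp
    · exact if_pos hp
end

section
/- Let P and Q be partial IP loops whose base sets intersect exactly in the common unit, P ∩ Q = {1}. Then the set P ∪ Q equipped with the partial operation with domain D(P) ∪ D(Q), given by the operation of P on D(P) and the operation of Q on D(Q), is a partial IP loop extending both P and Q. -/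
namespace PartialIPLoop

variable {α : Type*}

theorem left_mem (P : PartialIPLoop α) {x y : α} (h : (x, y) ∈ P.dom) : x ∈ P.carrier :=
  (P.dom_subset h).1

theorem right_mem (P : PartialIPLoop α) {x y : α} (h : (x, y) ∈ P.dom) : y ∈ P.carrier :=
  (P.dom_subset h).2

theorem inv_one (P : PartialIPLoop α) : P.inv P.one = P.one :=
  (P.inv_unique _ P.one_mem _ P.one_mem (P.one_mul_dom _ P.one_mem) (P.one_mul_dom _ P.one_mem)
    (P.one_mul _ P.one_mem) (P.one_mul _ P.one_mem)).symm

/-- An operation and an inversion on the union of the base sets restricting to those of two partial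
IP loops that meet exactly in their common unit. -/
theorem exists_mul_inv_union (P Q : PartialIPLoop α)
    (hone : P.one = Q.one) (hcap : P.carrier ∩ Q.carrier = {P.one}) :
    ∃ (mul : α → α → α) (inv : α → α),
      (∀ x y, (x, y) ∈ P.dom → mul x y = P.mul x y) ∧
      (∀ x y, (x, y) ∈ Q.dom → mul x y = Q.mul x y) ∧
      (∀ x ∈ P.carrier, inv x = P.inv x) ∧ (∀ x ∈ Q.carrier, inv x = Q.inv x) := by
  classical
  have eq_one : ∀ x, x ∈ P.carrier → x ∈ Q.carrier → x = P.one := fun x hP hQ => by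
    have h : x ∈ P.carrier ∩ Q.carrier := ⟨hP, hQ⟩
    rwa [hcap] at h
  refine ⟨fun x y => if (x, y) ∈ P.dom then P.mul x y else Q.mul x y,
    fun x => if x ∈ P.carrier then P.inv x else Q.inv x,
    fun x y h => if_pos h, fun x y h => ?_, fun x h => if_pos h, fun x h => ?_⟩
  · by_cases hP : (x, y) ∈ P.dom
    · obtain rfl := eq_one x (P.left_mem hP) (Q.left_mem h)
      obtain rfl := eq_one y (P.right_mem hP) (Q.right_mem h)
      simp only [if_pos hP]
      rw [P.one_mul _ P.one_mem, hone, Q.one_mul _ Q.one_mem]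
    · exact if_neg hP
  · by_cases hP : x ∈ P.carrier
    · obtain rfl := eq_one x hP h
      simp only [if_pos hP]
      rw [P.inv_one, hone, Q.inv_one]
    · exact if_neg hP

end PartialIPLoop

/-- The direct sum of two partial IP loops whose base sets meet exactly in the
common unit is a partial IP loop extending both. -/
theorem directSum_partialIPLoop {α : Type*} (P Q : PartialIPLoop α)
    (hone : P.one = Q.one) (hcap : P.carrier ∩ Q.carrier = {P.one}) :
    ∃ R : PartialIPLoop α, R.carrier = P.carrier ∪ Q.carrier ∧
      R.one = P.one ∧ R.dom = P.dom ∪ Q.dom ∧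
      (∀ p ∈ P.dom, R.mul p.1 p.2 = P.mul p.1 p.2) ∧
      (∀ p ∈ Q.dom, R.mul p.1 p.2 = Q.mul p.1 p.2) ∧
      P.Ext R ∧ Q.Ext R := by
  obtain ⟨mul, inv, mulP, mulQ, invP, invQ⟩ := P.exists_mul_inv_union Q hone hcap
  have eq_one : ∀ x, x ∈ P.carrier → x ∈ Q.carrier → x = P.one := fun x hP hQ => by
    have h : x ∈ P.carrier ∩ Q.carrier := ⟨hP, hQ⟩
    rwa [hcap] at h
  refine ⟨{
    carrier := P.carrier ∪ Q.carrier
    one := P.one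
    dom := P.dom ∪ Q.dom
    mul := mul
    inv := inv
    one_mem := Or.inl P.one_mem
    dom_subset := ?_
    mul_mem := ?_
    one_mul_dom := ?_
    mul_one_dom := ?_
    one_mul := ?_
    mul_one := ?_
    inv_mem := ?_
    mul_inv_dom := ?_
    inv_mul_dom := ?_
    mul_inv := ?_
    inv_mul := ?_
    inv_unique := ?_
    ip_left_dom := ?_
    ip_right_dom := ?_
    ip_left := ?_
    ip_right := ?_ }, rfl, rfl, rfl, fun p h => mulP _ _ h, fun p h => mulQ _ _ h,
    ⟨Set.subset_union_left, Set.subset_union_left, fun x y h => (mulP x y h).symm⟩,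
    ⟨Set.subset_union_right, Set.subset_union_right, fun x y h => (mulQ x y h).symm⟩⟩
  · rintro ⟨x, y⟩ (h | h)
    · exact ⟨Or.inl (P.left_mem h), Or.inl (P.right_mem h)⟩
    · exact ⟨Or.inr (Q.left_mem h), Or.inr (Q.right_mem h)⟩
  · rintro x y (h | h)
    · exact Or.inl (mulP x y h ▸ P.mul_mem x y h)
    · exact Or.inr (mulQ x y h ▸ Q.mul_mem x y h)
  · rintro x (h | h)
    · exact Or.inl (P.one_mul_dom x h)
    · exact Or.inr (hone ▸ Q.one_mul_dom x h)
  · rintro x (h | h)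
    · exact Or.inl (P.mul_one_dom x h)
    · exact Or.inr (hone ▸ Q.mul_one_dom x h)
  · rintro x (h | h)
    · rw [mulP _ _ (P.one_mul_dom x h), P.one_mul x h]
    · rw [hone, mulQ _ _ (Q.one_mul_dom x h), Q.one_mul x h]
  · rintro x (h | h)
    · rw [mulP _ _ (P.mul_one_dom x h), P.mul_one x h]
    · rw [hone, mulQ _ _ (Q.mul_one_dom x h), Q.mul_one x h]
  · rintro x (h | h)
    · exact Or.inl (invP x h ▸ P.inv_mem x h)
    · exact Or.inr (invQ x h ▸ Q.inv_mem x h)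
  · rintro x (h | h)
    · exact Or.inl ((invP x h).symm ▸ P.mul_inv_dom x h)
    · exact Or.inr ((invQ x h).symm ▸ Q.mul_inv_dom x h)
  · rintro x (h | h)
    · exact Or.inl ((invP x h).symm ▸ P.inv_mul_dom x h)
    · exact Or.inr ((invQ x h).symm ▸ Q.inv_mul_dom x h)
  · rintro x (h | h)
    · rw [invP x h, mulP _ _ (P.mul_inv_dom x h), P.mul_inv x h]
    · rw [invQ x h, mulQ _ _ (Q.mul_inv_dom x h), Q.mul_inv x h, hone]
  · rintro x (h | h)
    · rw [invP x h, mulP _ _ (P.inv_mul_dom x h), P.inv_mul x h]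
    · rw [invQ x h, mulQ _ _ (Q.inv_mul_dom x h), Q.inv_mul x h, hone]
  · have inv_one : inv P.one = P.one := by rw [invP _ P.one_mem, P.inv_one]
    rintro x - y - (h | h) (h' | h') hxy hyx
    · have hx := P.left_mem h
      rw [mulP _ _ h] at hxy
      rw [mulP _ _ h'] at hyx
      rw [invP x hx]
      exact P.inv_unique x hx y (P.right_mem h) h h' hxy hyx
    · rw [eq_one x (P.left_mem h) (Q.right_mem h'), eq_one y (P.right_mem h) (Q.left_mem h'),
        inv_one]
    · rw [eq_one x (P.right_mem h') (Q.left_mem h), eq_one y (P.left_mem h') (Q.right_mem h),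
        inv_one]
    · have hx := Q.left_mem h
      rw [mulQ _ _ h, hone] at hxy
      rw [mulQ _ _ h', hone] at hyx
      rw [invQ x hx]
      exact Q.inv_unique x hx y (Q.right_mem h) h h' hxy hyx
  · rintro x y (h | h)
    · rw [invP x (P.left_mem h), mulP x y h]
      exact Or.inl (P.ip_left_dom x y h)
    · rw [invQ x (Q.left_mem h), mulQ x y h]
      exact Or.inr (Q.ip_left_dom x y h)
  · rintro x y (h | h)
    · rw [invP y (P.right_mem h), mulP x y h]
      exact Or.inl (P.ip_right_dom x y h)
    · rw [invQ y (Q.right_mem h), mulQ x y h]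
      exact Or.inr (Q.ip_right_dom x y h)
  · rintro x y (h | h)
    · rw [invP x (P.left_mem h), mulP x y h, mulP _ _ (P.ip_left_dom x y h), P.ip_left x y h]
    · rw [invQ x (Q.left_mem h), mulQ x y h, mulQ _ _ (Q.ip_left_dom x y h), Q.ip_left x y h]
  · rintro x y (h | h)
    · rw [invP y (P.right_mem h), mulP x y h, mulP _ _ (P.ip_right_dom x y h), P.ip_right x y h]
    · rw [invQ y (Q.right_mem h), mulQ x y h, mulQ _ _ (Q.ip_right_dom x y h), Q.ip_right x y h]
end

section
/- Let P be a finite partial IP loop with #P even and Γ(P) ⊆ O₂(P) × O₂(P). Then the degree of each vertex in the gap graph G(P) is even; equivalently, for every x ∈ O₂(P) the number of elements y with (x,y) ∈ Γ(P) is even. -/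
/-- A finset carrying a fixed-point-free involution has even cardinality. -/
theorem Finset.even_card_of_fixedPointFree_involution {α : Type*} (s : Finset α) (f : α → α)
    (hf : ∀ a ∈ s, f a ∈ s) (hne : ∀ a ∈ s, f a ≠ a) (hinv : ∀ a ∈ s, f (f a) = a) :
    Even s.card := by
  have h : ∑ _a ∈ s, (1 : ZMod 2) = 0 :=
    Finset.sum_involution (fun a _ => f a) (fun _ _ => by decide) (fun a ha _ => hne a ha)
      hf hinv
  rw [Finset.sum_const, nsmul_one] at h
  exact ZMod.natCast_eq_zero_iff_even.mp h

namespace PartialIPLoop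

variable {α : Type*} (P : PartialIPLoop α)

theorem inv_eq_self_of_mem_O2 {x : α} (hx : x ∈ P.O2) : P.inv x = x :=
  (P.inv_unique x hx.1 x hx.1 hx.2.2.1 hx.2.2.1 hx.2.2.2 hx.2.2.2).symm

theorem eq_one_of_mul_eq_right {x y : α} (h : (x, y) ∈ P.dom) (hxy : P.mul x y = y) :
    x = P.one := by
  have h' := P.ip_right x y h
  rw [hxy, P.mul_inv y (P.dom_subset h).2] at h'
  exact h'.symm

/-- Left multiplication by an element of order two pairs up the elements it is defined on. -/
theorem even_ncard_dom_of_mem_O2 (hP : P.carrier.Finite) {x : α} (hx : x ∈ P.O2) :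
    Even {y : α | (x, y) ∈ P.dom}.ncard := by
  have hinv := P.inv_eq_self_of_mem_O2 hx
  have hfin : {y : α | (x, y) ∈ P.dom}.Finite := hP.subset fun y hy => (P.dom_subset hy).2
  rw [Set.ncard_eq_toFinset_card _ hfin]
  refine Finset.even_card_of_fixedPointFree_involution _ (P.mul x) (fun y hy => ?_)
    (fun y hy h => ?_) (fun y hy => ?_) <;>
    simp only [Set.Finite.mem_toFinset, Set.mem_ofPred_eq] at hy ⊢
  · simpa only [hinv] using P.ip_left_dom x y hy
  · exact hx.2.1 (P.eq_one_of_mul_eq_right hy h)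
  · simpa only [hinv] using P.ip_left x y hy

end PartialIPLoop

/-- Claim 3(a): if `P` is a finite partial IP loop with `#P` even and
`Γ(P) ⊆ O₂(P) × O₂(P)`, then every vertex of the gap graph has even degree:
for every `x ∈ O₂(P)` the number of `y` with `(x,y) ∈ Γ(P)` is even. -/
theorem gapGraph_degree_even {α : Type*} (P : PartialIPLoop α)
    (hP : P.carrier.Finite) (heven : Even P.carrier.ncard)
    (hgap : P.gaps ⊆ P.O2 ×ˢ P.O2) :
    ∀ x ∈ P.O2, Even {y : α | (x, y) ∈ P.gaps}.ncard := by
  intro x hx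
  have hsub : {y : α | (x, y) ∈ P.dom} ⊆ P.carrier := fun y hy => (P.dom_subset hy).2
  have hgaps : {y : α | (x, y) ∈ P.gaps} = P.carrier \ {y : α | (x, y) ∈ P.dom} := by
    ext y
    simp [PartialIPLoop.gaps, hx.1]
  have hcard := Set.ncard_sdiff_add_ncard_of_subset hsub hP
  rw [← hcard, Nat.even_add] at heven
  rw [hgaps]
  exact heven.mpr (P.even_ncard_dom_of_mem_O2 hP hx)
end
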